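/- arXiv:0905.1280 — 3 statements merged into one kernel-verified Lean document; each statement's English description precedes it below -/
import Mathlib

section
/- If R ⊆ C_ε is a Phan residue of type I, then δ^θ(c) ∈ W_I for every chamber c ∈ R. -/
universe u v

/-- A twin building of type `(W,S)` (where `S` is the set of simple reflections of the
Coxeter system `cs`), with positive half `Cp` and negative half `Cm`, distance functions
`δp`, `δm`, codistance `δst : Cp × Cm → W`, `δts : Cm × Cp → W`, together with a
quasi-flip: maps `θp : Cp → Cm`, `θm : Cm → Cp` inverse to each other and an automorphism
`π` of `W` with `π(S) = S`, `π ∘ π = id`, compatible with the distances and the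
codistance. -/
structure QuasiFlipTwinBuilding {B : Type*} {W : Type*} [Group W]
    (M : CoxeterMatrix B) (cs : CoxeterSystem M W)
    (Cp : Type u) (Cm : Type v) where
  δp : Cp → Cp → W
  δm : Cm → Cm → W
  δst : Cp → Cm → W
  δts : Cm → Cp → W
  θp : Cp → Cm
  θm : Cm → Cp
  π : W ≃* W
  nonempty_p : Nonempty Cp
  nonempty_m : Nonempty Cm
  /-- (Bu1) for the positive half -/
  p_eq_one_iff : ∀ x y : Cp, δp x y = 1 ↔ x = y
  /-- (Bu1) for the negative half -/
  m_eq_one_iff : ∀ x y : Cm, δm x y = 1 ↔ x = y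
  /-- (Bu2) for the positive half -/
  p_two : ∀ (x y z : Cp) (s : W), s ∈ Set.range cs.simple → δp y z = s →
    δp x z = δp x y ∨ δp x z = δp x y * s
  p_two' : ∀ (x y z : Cp) (s : W), s ∈ Set.range cs.simple → δp y z = s →
    cs.length (δp x y * s) = cs.length (δp x y) + 1 → δp x z = δp x y * s
  /-- (Bu2) for the negative half -/
  m_two : ∀ (x y z : Cm) (s : W), s ∈ Set.range cs.simple → δm y z = s →
    δm x z = δm x y ∨ δm x z = δm x y * s
  m_two' : ∀ (x y z : Cm) (s : W), s ∈ Set.range cs.simple → δm y z = s →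
    cs.length (δm x y * s) = cs.length (δm x y) + 1 → δm x z = δm x y * s
  /-- (Bu3) for the positive half -/
  p_three : ∀ (x y : Cp) (s : W), s ∈ Set.range cs.simple →
    ∃ z : Cp, δp y z = s ∧ δp x z = δp x y * s
  /-- (Bu3) for the negative half -/
  m_three : ∀ (x y : Cm) (s : W), s ∈ Set.range cs.simple →
    ∃ z : Cm, δm y z = s ∧ δm x z = δm x y * s
  /-- (Tw1) -/
  tw1 : ∀ (x : Cp) (y : Cm), δts y x = (δst x y)⁻¹
  /-- (Tw2), positive-to-negative -/
  tw2p : ∀ (x : Cp) (y z : Cm) (s : W), s ∈ Set.range cs.simple → δm y z = s →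
    cs.length (δst x y * s) + 1 = cs.length (δst x y) → δst x z = δst x y * s
  /-- (Tw2), negative-to-positive -/
  tw2m : ∀ (x : Cm) (y z : Cp) (s : W), s ∈ Set.range cs.simple → δp y z = s →
    cs.length (δts x y * s) + 1 = cs.length (δts x y) → δts x z = δts x y * s
  /-- (Tw3), positive-to-negative -/
  tw3p : ∀ (x : Cp) (y : Cm) (s : W), s ∈ Set.range cs.simple →
    ∃ z : Cm, δm y z = s ∧ δst x z = δst x y * s
  /-- (Tw3), negative-to-positive -/
  tw3m : ∀ (x : Cm) (y : Cp) (s : W), s ∈ Set.range cs.simple →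
    ∃ z : Cp, δp y z = s ∧ δts x z = δts x y * s
  /-- `θ ∘ θ = id` -/
  θmθp : ∀ c : Cp, θm (θp c) = c
  θpθm : ∀ c : Cm, θp (θm c) = c
  /-- `π(S) = S` -/
  πS : ⇑π '' Set.range cs.simple = Set.range cs.simple
  /-- `π ∘ π = id` -/
  ππ : ∀ w : W, π (π w) = w
  /-- `θ` interchanges the distances via `π` -/
  flip_p : ∀ x y : Cp, δm (θp x) (θp y) = π (δp x y)
  flip_m : ∀ x y : Cm, δp (θm x) (θm y) = π (δm x y)
  /-- `θ` preserves the codistance via `π` -/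
  flip_st : ∀ (x : Cp) (z : Cm), δts (θp x) (θm z) = π (δst x z)
  flip_ts : ∀ (x : Cm) (z : Cp), δst (θm x) (θp z) = π (δts x z)

namespace QuasiFlipTwinBuilding

variable {B : Type*} {W : Type*} [Group W] {M : CoxeterMatrix B} {cs : CoxeterSystem M W}
  {Cp : Type u} {Cm : Type v}

/-- The same twin building with a quasi-flip, with the roles of the two halves
interchanged. -/
def swap (T : QuasiFlipTwinBuilding M cs Cp Cm) : QuasiFlipTwinBuilding M cs Cm Cp where
  δp := T.δm
  δm := T.δp
  δst := T.δts
  δts := T.δst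
  θp := T.θm
  θm := T.θp
  π := T.π
  nonempty_p := T.nonempty_m
  nonempty_m := T.nonempty_p
  p_eq_one_iff := T.m_eq_one_iff
  m_eq_one_iff := T.p_eq_one_iff
  p_two := T.m_two
  p_two' := T.m_two'
  m_two := T.p_two
  m_two' := T.p_two'
  p_three := T.m_three
  m_three := T.p_three
  tw1 := fun x y => by rw [T.tw1 y x, inv_inv]
  tw2p := T.tw2m
  tw2m := T.tw2p
  tw3p := T.tw3m
  tw3m := T.tw3p
  θmθp := T.θpθm
  θpθm := T.θmθp
  πS := T.πS
  ππ := T.ππ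
  flip_p := T.flip_m
  flip_m := T.flip_p
  flip_st := T.flip_ts
  flip_ts := T.flip_st

variable (T : QuasiFlipTwinBuilding M cs Cp Cm)

/-- The `θ`-codistance `δ^θ(c) = δ*(c, θ(c))` of a chamber of the positive half. -/
def δθ (c : Cp) : W := T.δst c (T.θp c)

/-- The numerical `θ`-codistance `ℓ^θ(c) = ℓ(δ^θ(c))`. -/
noncomputable def ℓθ (c : Cp) : ℕ := cs.length (T.δθ c)

/-- The `s`-panel of a chamber `c`. -/
def panel (s : W) (c : Cp) : Set Cp := {d | T.δp c d = 1 ∨ T.δp c d = s}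

/-- The `J`-residue of a chamber `c`. -/
def residue (J : Set W) (c : Cp) : Set Cp := {d | T.δp c d ∈ Subgroup.closure J}

/-- Opposition of chambers: `δ*(c,d) = 1`. -/
def Opp (c : Cp) (d : Cm) : Prop := T.δst c d = 1

/-- `R` is a Phan residue of type `J`: `R` is a `J`-residue, every chamber of `R` is
opposite some chamber of `θ(R)`, and every chamber of `θ(R)` is opposite some chamber
of `R`. -/
def IsPhan (J : Set W) (R : Set Cp) : Prop :=
  (∃ c : Cp, R = T.residue J c) ∧
  (∀ r ∈ R, ∃ r' ∈ R, T.Opp r (T.θp r')) ∧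
  (∀ r' ∈ R, ∃ r ∈ R, T.Opp r (T.θp r'))

/-- `R` is a minimal Phan residue of type `J`: it is a Phan residue containing no Phan
residue as a proper subset. -/
def IsMinPhan (J : Set W) (R : Set Cp) : Prop :=
  T.IsPhan J R ∧ ∀ (J' : Set W) (R' : Set Cp), J' ⊆ Set.range cs.simple →
    T.IsPhan J' R' → R' ⊆ R → R' = R

/-- Two chambers are `J`-adjacent: they are `j`-adjacent for some `j ∈ J`. -/
def adjJ (J : Set W) (c d : Cp) : Prop := ∃ j ∈ J, T.δp c d = 1 ∨ T.δp c d = j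

/-- There is a `J`-gallery from `c` to `d` all of whose chambers lie in `X`. -/
def GalleryIn (X : Set Cp) (J : Set W) (c d : Cp) : Prop :=
  ∃ γ : List Cp, γ.head? = some c ∧ γ.getLast? = some d ∧
    γ.Chain' (T.adjJ J) ∧ ∀ x ∈ γ, x ∈ X

/-- The flip-flop system of a set `R` of chambers: the chambers of `R` whose numerical
`θ`-codistance is minimal among chambers of `R`. -/
def flipflop (R : Set Cp) : Set Cp := {c ∈ R | ∀ d ∈ R, T.ℓθ c ≤ T.ℓθ d}

/-- The flip-flop system `R^θ` is connected: any two of its chambers are joined by a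
gallery all of whose chambers lie in `R^θ`. -/
def ConnectedFF (R : Set Cp) : Prop :=
  ∀ c ∈ T.flipflop R, ∀ d ∈ T.flipflop R,
    T.GalleryIn (T.flipflop R) (Set.range cs.simple) c d

/-- `R` admits direct descent into `R^θ`: from every chamber of `R` there is a gallery
within `R` ending in `R^θ` along which the numerical `θ`-codistance strictly decreases. -/
def DirectDescent (R : Set Cp) : Prop :=
  ∀ c ∈ R, ∃ γ : List Cp, γ.head? = some c ∧
    (∃ e, γ.getLast? = some e ∧ e ∈ T.flipflop R) ∧
    γ.Chain' (T.adjJ (Set.range cs.simple)) ∧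
    γ.Chain' (fun a b => T.ℓθ b < T.ℓθ a) ∧
    ∀ x ∈ γ, x ∈ R

/-- The quasi-flip is strong on this half: for every chamber `c` and every `s ∈ S` there
are chambers `d, x` in the `s`-panel of `c` with `ℓ(δ*(x, θ(d))) > ℓ(δ*(d, θ(d)))`,
i.e. the projection of `θ(d)` onto the panel is not `d`. -/
def IsStrongHalf : Prop :=
  ∀ (c : Cp) (s : W), s ∈ Set.range cs.simple →
    ∃ d ∈ T.panel s c, ∃ x ∈ T.panel s c,
      cs.length (T.δst d (T.θp d)) < cs.length (T.δst x (T.θp d))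

end QuasiFlipTwinBuilding

namespace QuasiFlipTwinBuilding

variable {B : Type*} {W : Type*} [Group W] {M : CoxeterMatrix B} {cs : CoxeterSystem M W}
  {Cp : Type u} {Cm : Type v} (T : QuasiFlipTwinBuilding M cs Cp Cm)

lemma simple_mul_self_of_mem_range {s : W} (hs : s ∈ Set.range cs.simple) : s * s = 1 := by
  obtain ⟨i, rfl⟩ := hs
  exact cs.simple_mul_simple_self i

lemma δm_symm_of_simple {y z : Cm} {s : W} (hs : s ∈ Set.range cs.simple)
    (h : T.δm y z = s) : T.δm z y = s := by
  obtain ⟨u, hu, hyu⟩ := T.m_three y z s hs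
  rw [h, simple_mul_self_of_mem_range hs, T.m_eq_one_iff] at hyu
  rwa [hyu]

/-- Crossing an `s`-panel changes the codistance to a fixed chamber by a factor `1` or `s`. -/
lemma δst_of_adjacent (x : Cp) {y z : Cm} {s : W} (hs : s ∈ Set.range cs.simple)
    (h : T.δm y z = s) : T.δst x z = T.δst x y ∨ T.δst x z = T.δst x y * s := by
  have hss := simple_mul_self_of_mem_range hs
  have hlen : ∀ w : W, cs.length (w * s) = cs.length w + 1 ∨
      cs.length (w * s) + 1 = cs.length w := by
    obtain ⟨i, rfl⟩ := hs
    exact fun w => cs.length_mul_simple w i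
  rcases hlen (T.δst x y) with hup | hdown
  · obtain ⟨y', hyy', hxy'⟩ := T.tw3p x y s hs
    rcases T.m_two y' y z s hs h with h1 | h1
    · rw [T.δm_symm_of_simple hs hyy'] at h1
      left
      have hback : T.δst x y' * s = T.δst x y := by rw [hxy', mul_assoc, hss, mul_one]
      rw [← hback]
      exact T.tw2p x y' z s hs h1 (by rw [hback, hxy', hup])
    · rw [T.δm_symm_of_simple hs hyy', hss, T.m_eq_one_iff] at h1
      exact Or.inr (h1 ▸ hxy')
  · exact Or.inr (T.tw2p x y z s hs h hdown)

/-- If a `W`-valued function on chambers changes by right factors in `H` across all `J`-panels,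
then its values on a `J`-residue lie in a single left coset of `H`. -/
lemma inv_mul_mem_of_δp_mem_closure {J : Set W} (hJ : J ⊆ Set.range cs.simple)
    (H : Subgroup W) (f : Cp → W)
    (hf : ∀ y z, T.δp y z ∈ J → (f y)⁻¹ * f z ∈ H) {y z : Cp}
    (h : T.δp y z ∈ Subgroup.closure J) : (f y)⁻¹ * f z ∈ H := by
  obtain ⟨w, hw⟩ : ∃ w, w = T.δp y z := ⟨_, rfl⟩
  rw [← hw] at h
  have step : ∀ v s, s ∈ J → (∀ z, v * s = T.δp y z → (f y)⁻¹ * f z ∈ H) →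
      ∀ z, v = T.δp y z → (f y)⁻¹ * f z ∈ H := by
    intro v s hs ih z hz
    obtain ⟨u, hzu, hyu⟩ := T.p_three y z s (hJ hs)
    have h1 := ih u (by rw [hyu, hz])
    have h2 := hf z u (by rwa [hzu])
    have h3 := H.mul_mem h1 (H.inv_mem h2)
    simpa [mul_assoc] using h3
  induction h using Subgroup.closure_induction_right generalizing z with
  | one =>
    rw [(T.p_eq_one_iff y z).1 hw.symm]
    simp
  | mul_right v _ s hs ih =>
    refine step (v * s) s hs (fun z hz => ih ?_) z hw
    rwa [mul_assoc, simple_mul_self_of_mem_range (hJ hs), mul_one] at hz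
  | mul_inv_cancel v _ s hs ih =>
    refine step (v * s⁻¹) s hs (fun z hz => ih ?_) z hw
    rwa [inv_mul_cancel_right] at hz

lemma δp_inv_mul_mem {J : Set W} (hJ : J ⊆ Set.range cs.simple) (x : Cp) {y z : Cp}
    (h : T.δp y z ∈ Subgroup.closure J) :
    (T.δp x y)⁻¹ * T.δp x z ∈ Subgroup.closure J := by
  refine T.inv_mul_mem_of_δp_mem_closure hJ _ (T.δp x) (fun y z hyz => ?_) h
  rcases T.p_two x y z _ (hJ hyz) rfl with h | h
  · simp [h]
  · rw [h, inv_mul_cancel_left]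
    exact Subgroup.subset_closure hyz

lemma δp_mem_of_mem_residue {J : Set W} (hJ : J ⊆ Set.range cs.simple) {c x y : Cp}
    (hx : x ∈ T.residue J c) (hy : y ∈ T.residue J c) :
    T.δp x y ∈ Subgroup.closure J := by
  have h1 := T.δp_inv_mul_mem hJ x hx
  rw [(T.p_eq_one_iff x x).2 rfl, mul_one] at h1
  exact ((Subgroup.closure J).mul_mem_cancel_left h1).1 (T.δp_inv_mul_mem hJ x hy)

lemma δst_θp_inv_mul_mem {J : Set W} (hJ : J ⊆ Set.range cs.simple) (x : Cp) {y z : Cp}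
    (h : T.δp y z ∈ Subgroup.closure J) :
    (T.δst x (T.θp y))⁻¹ * T.δst x (T.θp z) ∈
      (Subgroup.closure J).map T.π.toMonoidHom := by
  refine T.inv_mul_mem_of_δp_mem_closure hJ _ (fun c => T.δst x (T.θp c))
    (fun y z hyz => ?_) h
  have hs : T.π (T.δp y z) ∈ Set.range cs.simple :=
    T.πS ▸ Set.mem_image_of_mem _ (hJ hyz)
  rcases T.δst_of_adjacent x hs (T.flip_p y z) with h | h
  · simp [h]
  · simp only [h, inv_mul_cancel_left]
    exact Subgroup.mem_map_of_mem T.π.toMonoidHom (Subgroup.subset_closure hyz)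

/-- The type of a nonempty Phan residue is stable under the automorphism of the quasi-flip. -/
lemma IsPhan.map_closure_le {I : Set W} (hI : I ⊆ Set.range cs.simple) {R : Set Cp}
    (hR : T.IsPhan I R) {c : Cp} (hc : c ∈ R) :
    (Subgroup.closure I).map T.π.toMonoidHom ≤ Subgroup.closure I := by
  obtain ⟨⟨c₀, rfl⟩, hopp, -⟩ := hR
  have hle : Subgroup.closure I ≤ (Subgroup.closure I).map T.π.toMonoidHom := by
    refine (Subgroup.closure_le _).2 fun s hs => ?_
    obtain ⟨d, hd, hcd⟩ := hopp c hc
    obtain ⟨z, hcz, hdz⟩ := T.tw3m (T.θp d) c s (hI hs)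
    have hz : z ∈ T.residue I c₀ := by
      have h1 := T.δp_inv_mul_mem hI c₀ (y := c) (z := z)
        (hcz ▸ Subgroup.subset_closure hs)
      exact ((Subgroup.closure I).mul_mem_cancel_left (inv_mem hc)).1 h1
    obtain ⟨e, he, hze⟩ := hopp z hz
    have h2 := T.δst_θp_inv_mul_mem hI z (T.δp_mem_of_mem_residue hI hd he)
    have hcd' : T.δst c (T.θp d) = 1 := hcd
    have hze' : T.δst z (T.θp e) = 1 := hze
    rwa [hze', mul_one, ← T.tw1, hdz, T.tw1, hcd', inv_one, one_mul] at h2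
  rintro _ ⟨u, hu, rfl⟩
  obtain ⟨v, hv, rfl⟩ := hle hu
  change T.π (T.π v) ∈ _
  rwa [T.ππ]

end QuasiFlipTwinBuilding

open QuasiFlipTwinBuilding in
/-- If `R` is a Phan residue of type `I`, then the `θ`-codistance of every chamber of `R`
lies in `W_I`. -/
theorem thetaCodistance_mem_of_isPhan
    {B : Type*} {W : Type*} [Group W] {M : CoxeterMatrix B} {cs : CoxeterSystem M W}
    {Cp : Type u} {Cm : Type v} (T : QuasiFlipTwinBuilding M cs Cp Cm)
    (I : Set W) (hI : I ⊆ Set.range cs.simple) (R : Set Cp) (hR : T.IsPhan I R) :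
    ∀ c ∈ R, T.δθ c ∈ Subgroup.closure I := by
  intro c hc
  refine hR.map_closure_le T hI hc ?_
  obtain ⟨⟨c₀, rfl⟩, hopp, -⟩ := hR
  obtain ⟨d, hd, hcd⟩ := hopp c hc
  have h := T.δst_θp_inv_mul_mem hI c (T.δp_mem_of_mem_residue hI hd hc)
  have hcd' : T.δst c (T.θp d) = 1 := hcd
  rwa [hcd', inv_one, one_mul] at h
end

section
/- Suppose the quasi-flip θ is strong. Let c ∈ C_ε be a chamber with w := δ^θ(c), and suppose there exists s ∈ S with ℓ(sw) < ℓ(w). Then there exists a chamber d ∈ P_s(c) with ℓ^θ(d) < ℓ^θ(c). In particular, every strong quasi-flip is proper: there exists a chamber c with δ^θ(c) = 1. -/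
universe u v

namespace QuasiFlipTwinBuilding

variable {B : Type*} {W : Type*} [Group W] {M : CoxeterMatrix B} {cs : CoxeterSystem M W}
  {Cp : Type u} {Cm : Type v} (T : QuasiFlipTwinBuilding M cs Cp Cm)

theorem δp_symm {s : W} (hs : s ∈ Set.range cs.simple) {c d : Cp} (h : T.δp c d = s) :
    T.δp d c = s := by
  have hss : s * s = 1 := by
    obtain ⟨i, rfl⟩ := hs
    exact cs.simple_mul_simple_self i
  have hdd := (T.p_eq_one_iff d d).2 rfl
  rcases T.p_two d c d s hs h with h1 | h1 <;> rw [hdd] at h1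
  · obtain rfl := (T.p_eq_one_iff d c).1 h1.symm
    exact h
  · exact mul_right_cancel (h1.symm.trans hss.symm)

/-- Two distinct chambers of an `s`-panel are at distance `s`. -/
theorem δp_eq_of_mem_panel {s : W} (hs : s ∈ Set.range cs.simple) {c d x : Cp}
    (hd : d ∈ T.panel s c) (hx : x ∈ T.panel s c) (hdx : d ≠ x) : T.δp d x = s := by
  have hss : s * s = 1 := by
    obtain ⟨i, rfl⟩ := hs
    exact cs.simple_mul_simple_self i
  rcases hd with hd | hd
  · obtain rfl := (T.p_eq_one_iff c d).1 hd
    exact hx.resolve_left fun h => hdx ((T.p_eq_one_iff c x).1 h)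
  · have hdc := T.δp_symm hs hd
    rcases hx with hx | hx
    · obtain rfl := (T.p_eq_one_iff c x).1 hx
      exact hdc
    · rcases T.p_two d c x s hs hx with h | h
      · exact h.trans hdc
      · rw [hdc, hss] at h
        exact absurd ((T.p_eq_one_iff d x).1 h) hdx

/-- If `ℓ(s δ*(x,y)) < ℓ(δ*(x,y))`, then every chamber `s`-adjacent to `x` and different from it
has codistance `s δ*(x,y)` from `y`. -/
theorem δst_eq_of_length_lt {s : W} (hs : s ∈ Set.range cs.simple) {x z : Cp} {y : Cm}
    (hxz : T.δp x z = s) (h : cs.length (s * T.δst x y) < cs.length (T.δst x y)) :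
    T.δst z y = s * T.δst x y := by
  have hinv : T.δts y x * s = (s * T.δst x y)⁻¹ := by
    obtain ⟨i, rfl⟩ := hs
    rw [T.tw1, mul_inv_rev, cs.inv_simple]
  have hlen : cs.length (s * T.δst x y) + 1 = cs.length (T.δst x y) := by
    obtain ⟨i, rfl⟩ := hs
    rcases cs.length_simple_mul (T.δst x y) i with h' | h' <;> omega
  have := T.tw2m y x z s hs hxz (by rw [hinv, T.tw1, cs.length_inv, cs.length_inv]; exact hlen)
  rw [hinv, T.tw1] at this
  exact inv_injective this

/-- The codistance from a fixed chamber takes at most two values `w`, `s w` on an `s`-panel. -/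
theorem δst_eq_or_eq {s : W} (hs : s ∈ Set.range cs.simple) {x z : Cp} {y : Cm}
    (hxz : T.δp x z = s) : T.δst z y = T.δst x y ∨ T.δst z y = s * T.δst x y := by
  obtain ⟨i, rfl⟩ := id hs
  rcases cs.length_simple_mul (T.δst x y) i with h | h
  · obtain ⟨z', hz', h'⟩ := T.tw3m y x _ hs
    have hz'y : T.δst z' y = cs.simple i * T.δst x y := by
      rw [T.tw1, T.tw1] at h'
      simpa using congrArg (·⁻¹) h'
    by_cases hzz : z' = z
    · exact Or.inr (hzz ▸ hz'y)
    · have hd := T.δp_eq_of_mem_panel hs (Or.inr hz') (Or.inr hxz) hzz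
      refine Or.inl ?_
      rw [T.δst_eq_of_length_lt hs hd (by rw [hz'y, cs.simple_mul_simple_cancel_left]; omega),
        hz'y, cs.simple_mul_simple_cancel_left]
  · exact Or.inr (T.δst_eq_of_length_lt hs hxz (by omega))

theorem map_π_δθ (c : Cp) : T.π (T.δθ c) = (T.δθ c)⁻¹ := by
  rw [δθ, ← T.flip_st, T.θmθp, T.tw1]

theorem π_mem_range {s : W} (hs : s ∈ Set.range cs.simple) : T.π s ∈ Set.range cs.simple :=
  T.πS ▸ Set.mem_image_of_mem _ hs

/-- `π` permutes the simple reflections, so it does not increase the length. -/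
theorem length_π_le (w : W) : cs.length (T.π w) ≤ cs.length w := by
  obtain ⟨l, hl, rfl⟩ := cs.exists_isReduced w
  choose f hf using fun i => T.π_mem_range (Set.mem_range_self (f := cs.simple) i)
  have : T.π (cs.wordProd l) = cs.wordProd (l.map f) := by
    simp only [CoxeterSystem.wordProd, map_list_prod, List.map_map]
    congr 2
    funext i
    exact (hf i).symm
  rw [this, hl]
  simpa using cs.length_wordProd_le (l.map f)

theorem length_π (w : W) : cs.length (T.π w) = cs.length w :=
  (T.length_π_le w).antisymm (by simpa [T.ππ] using T.length_π_le (T.π w))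

/-- On the `s`-panel of `c`, the `θ`-codistance takes values `s w` or `s w π(s)` away from `c`
when `w = δ^θ(c)` satisfies `ℓ(s w) < ℓ(w)`. -/
theorem δθ_eq_or_eq {s : W} (hs : s ∈ Set.range cs.simple) {c d : Cp} (hcd : T.δp c d = s)
    (h : cs.length (s * T.δθ c) < cs.length (T.δθ c)) :
    T.δθ d = s * T.δθ c ∨ T.δθ d = s * T.δθ c * T.π s := by
  have hdc : T.δst d (T.θp c) = s * T.δθ c := T.δst_eq_of_length_lt hs hcd h
  have hinv : (T.π s)⁻¹ = T.π s := by
    obtain ⟨i, hi⟩ := T.π_mem_range hs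
    rw [← hi, cs.inv_simple]
  have hθ : T.δm (T.θp c) (T.θp d) = T.π s := by rw [T.flip_p, hcd]
  have := T.swap.δst_eq_or_eq (y := d) (T.π_mem_range hs) hθ
  change T.δts _ _ = T.δts _ _ ∨ T.δts _ _ = _ * T.δts _ _ at this
  rw [T.tw1, T.tw1, hdc] at this
  refine this.imp (fun h => inv_injective h) fun h => ?_
  rw [← hinv, ← mul_inv_rev] at h
  simpa [δθ] using inv_injective h

theorem exists_ℓθ_lt (hT : T.IsStrongHalf) {c : Cp} {s : W} (hs : s ∈ Set.range cs.simple)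
    (h : cs.length (s * T.δθ c) < cs.length (T.δθ c)) :
    ∃ d ∈ T.panel s c, T.ℓθ d < T.ℓθ c := by
  obtain ⟨d, hd, x, hx, hlt⟩ := hT c s hs
  have hup : ¬ cs.length (s * T.δθ d) < cs.length (T.δθ d) := fun hdown => by
    have hdx : d ≠ x := by
      rintro rfl
      exact lt_irrefl _ hlt
    have := T.δst_eq_of_length_lt hs (T.δp_eq_of_mem_panel hs hd hx hdx) hdown
    rw [this] at hlt
    exact lt_asymm hlt hdown
  refine ⟨d, hd, ?_⟩
  have hcd : T.δp c d = s := hd.resolve_left fun h1 => by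
    obtain rfl := (T.p_eq_one_iff c d).1 h1
    exact hup h
  have hright : cs.length (T.δθ c * T.π s) = cs.length (s * T.δθ c) := by
    have hπ : T.π (T.δθ c * T.π s) = (s * T.δθ c)⁻¹ := by
      obtain ⟨i, rfl⟩ := hs
      rw [map_mul, T.ππ, T.map_π_δθ, mul_inv_rev, cs.inv_simple]
    rw [← T.length_π, hπ, cs.length_inv]
  rcases T.δθ_eq_or_eq hs hcd h with hdθ | hdθ
  · simpa only [ℓθ, hdθ] using h
  · have hsd : s * T.δθ d = T.δθ c * T.π s := by
      obtain ⟨i, rfl⟩ := hs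
      rw [hdθ, mul_assoc, cs.simple_mul_simple_cancel_left]
    rw [hsd, hright] at hup
    exact (not_lt.1 hup).trans_lt h

end QuasiFlipTwinBuilding

open QuasiFlipTwinBuilding in
/-- Suppose the quasi-flip `θ` is strong (on both halves).  If `c` is a chamber with
`w := δ^θ(c)` and there is `s ∈ S` with `ℓ(sw) < ℓ(w)`, then there is a chamber `d` in
the `s`-panel of `c` with `ℓ^θ(d) < ℓ^θ(c)`.  In particular every strong quasi-flip is
proper: there exists a chamber `c` with `δ^θ(c) = 1`. -/
theorem strong_quasiflip_descent_and_proper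
    {B : Type*} {W : Type*} [Group W] {M : CoxeterMatrix B} {cs : CoxeterSystem M W}
    {Cp : Type u} {Cm : Type v} (T : QuasiFlipTwinBuilding M cs Cp Cm)
    (hstrongp : T.IsStrongHalf) (hstrongm : T.swap.IsStrongHalf) :
    (∀ (c : Cp) (s : W), s ∈ Set.range cs.simple →
      cs.length (s * T.δθ c) < cs.length (T.δθ c) →
      ∃ d ∈ T.panel s c, T.ℓθ d < T.ℓθ c) ∧
    (∃ c : Cp, T.δθ c = 1) := by
  refine ⟨fun c s hs h => T.exists_ℓθ_lt hstrongp hs h, ?_⟩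
  have := T.nonempty_p
  let c := Function.argmin T.ℓθ
  refine ⟨c, by_contra fun hc => ?_⟩
  obtain ⟨i, hi⟩ := cs.exists_leftDescent_of_ne_one hc
  obtain ⟨d, -, hd⟩ := T.exists_ℓθ_lt hstrongp (Set.mem_range_self i) hi
  exact Function.not_lt_argmin T.ℓθ d hd
end

section
/- Let R be a residue of type J with |J| = 2 such that R admits direct descent into R^θ and R^θ is connected. Let (c₀,c₁,c₂) be a gallery in R satisfying ℓ^θ(c₀) < ℓ^θ(c₁) and ℓ^θ(c₁) ≥ ℓ^θ(c₂). Then there exists a gallery γ in R from c₀ to c₂ such that every chamber d of γ other than possibly c₂ satisfies ℓ^θ(d) < ℓ^θ(c₁). -/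
universe u v

namespace QuasiFlipTwinBuilding

variable {B : Type*} {W : Type*} [Group W] {M : CoxeterMatrix B} {cs : CoxeterSystem M W}
  {Cp : Type u} {Cm : Type v}

/-- `J`-adjacency is reflexive when `J` is nonempty. -/
lemma adjJ_refl (T : QuasiFlipTwinBuilding M cs Cp Cm) {J : Set W} (hJ : J.Nonempty) (c : Cp) :
    T.adjJ J c c :=
  let ⟨j, hj⟩ := hJ
  ⟨j, hj, Or.inl ((T.p_eq_one_iff c c).2 rfl)⟩

/-- `J`-adjacency is symmetric. -/
lemma adjJ_symm (T : QuasiFlipTwinBuilding M cs Cp Cm) {J : Set W}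
    (hJ : J ⊆ Set.range cs.simple) {c d : Cp} (h : T.adjJ J c d) : T.adjJ J d c := by
  obtain ⟨j, hj, h | h⟩ := h
  · exact ⟨j, hj, Or.inl ((T.p_eq_one_iff d c).2 ((T.p_eq_one_iff c d).1 h).symm)⟩
  · refine ⟨j, hj, ?_⟩
    have hdd : T.δp d d = 1 := (T.p_eq_one_iff d d).2 rfl
    rcases T.p_two d c d j (hJ hj) h with h' | h'
    · exact Or.inl (h'.symm.trans hdd)
    · right
      obtain ⟨i, rfl⟩ := hJ hj
      rw [hdd] at h'
      simpa using (eq_inv_of_mul_eq_one_left h'.symm)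

/-- Along a strictly descending gallery, every chamber other than the first one has smaller
numerical `θ`-codistance than the first one. -/
lemma eq_or_ℓθ_lt_of_mem_descending (T : QuasiFlipTwinBuilding M cs Cp Cm) {γ : List Cp} {c : Cp}
    (hc : γ.head? = some c) (hγ : γ.IsChain fun a b => T.ℓθ b < T.ℓθ a) :
    ∀ x ∈ γ, x = c ∨ T.ℓθ x < T.ℓθ c := by
  obtain ⟨l, rfl⟩ := List.head?_eq_some_iff.1 hc
  have : IsTrans Cp fun a b => T.ℓθ b < T.ℓθ a := ⟨fun _ _ _ h h' => h'.trans h⟩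
  have h := List.pairwise_cons.1 (List.isChain_iff_pairwise.1 hγ)
  intro x hx
  exact (List.mem_cons.1 hx).imp_right (h.1 x)

end QuasiFlipTwinBuilding

open QuasiFlipTwinBuilding in
/-- Let `R` be a rank-two residue admitting direct descent into a connected flip-flop
system `R^θ`, and let `(c₀,c₁,c₂)` be a gallery in `R` with `ℓ^θ(c₀) < ℓ^θ(c₁)` and
`ℓ^θ(c₁) ≥ ℓ^θ(c₂)`.  Then there is a gallery in `R` from `c₀` to `c₂` all of whose
chambers `d`, except possibly `c₂`, satisfy `ℓ^θ(d) < ℓ^θ(c₁)`. -/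
theorem rank_two_bypass
    {B : Type*} {W : Type*} [Group W] {M : CoxeterMatrix B} {cs : CoxeterSystem M W}
    {Cp : Type u} {Cm : Type v} (T : QuasiFlipTwinBuilding M cs Cp Cm)
    (J : Set W) (hJ : J ⊆ Set.range cs.simple) (hJ2 : J.ncard = 2)
    (R : Set Cp) (hRres : ∃ c : Cp, R = T.residue J c)
    (hdd : T.DirectDescent R) (hconn : T.ConnectedFF R)
    (c₀ c₁ c₂ : Cp) (h0 : c₀ ∈ R) (h1 : c₁ ∈ R) (h2 : c₂ ∈ R)
    (ha01 : T.adjJ (Set.range cs.simple) c₀ c₁)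
    (ha12 : T.adjJ (Set.range cs.simple) c₁ c₂)
    (hl0 : T.ℓθ c₀ < T.ℓθ c₁) (hl2 : T.ℓθ c₂ ≤ T.ℓθ c₁) :
    ∃ γ : List Cp, γ.head? = some c₀ ∧ γ.getLast? = some c₂ ∧
      γ.Chain' (T.adjJ (Set.range cs.simple)) ∧ (∀ x ∈ γ, x ∈ R) ∧
      ∀ x ∈ γ, x = c₂ ∨ T.ℓθ x < T.ℓθ c₁ := by
  have hne : (Set.range cs.simple).Nonempty := let ⟨j, hj, _⟩ := ha01; ⟨j, hj⟩
  obtain ⟨γ₀, hd₀, ⟨e₀, hl₀, he₀⟩, hadj₀, hdesc₀, hR₀⟩ := hdd c₀ h0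
  obtain ⟨γ₂, hd₂, ⟨e₂, hl₂, he₂⟩, hadj₂, hdesc₂, hR₂⟩ := hdd c₂ h2
  obtain ⟨γ, hd, hl, hadj, hFF⟩ := hconn e₀ he₀ e₂ he₂
  refine ⟨γ₀ ++ (γ ++ γ₂.reverse), ?_, ?_, ?_, ?_, ?_⟩
  · simp [hd₀]
  · simp [hd₂]
  · have hrev : γ₂.reverse.IsChain (T.adjJ (Set.range cs.simple)) :=
      List.isChain_reverse.2 (hadj₂.imp fun _ _ => T.adjJ_symm subset_rfl)
    refine List.IsChain.append hadj₀ (List.IsChain.append hadj hrev ?_) ?_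
    · intro x hx y hy
      rw [List.head?_reverse] at hy
      simp only [hl, hl₂, Option.mem_some_iff] at hx hy
      subst hx hy
      exact T.adjJ_refl hne _
    · intro x hx y hy
      simp only [hl₀, hd, List.head?_append, Option.some_or, Option.mem_some_iff] at hx hy
      subst hx hy
      exact T.adjJ_refl hne _
  · intro x hx
    simp only [List.mem_append, List.mem_reverse] at hx
    rcases hx with hx | hx | hx
    exacts [hR₀ x hx, (hFF x hx).1, hR₂ x hx]
  · intro x hx
    simp only [List.mem_append, List.mem_reverse] at hx
    rcases hx with hx | hx | hx
    · rcases T.eq_or_ℓθ_lt_of_mem_descending hd₀ hdesc₀ x hx with rfl | h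
      exacts [Or.inr hl0, Or.inr (h.trans hl0)]
    · exact Or.inr (((hFF x hx).2 c₀ h0).trans_lt hl0)
    · exact (T.eq_or_ℓθ_lt_of_mem_descending hd₂ hdesc₂ x hx).imp_right fun h => h.trans_le hl2
end
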